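/- (Rogers–Ramanujan–Gordon identities) For all integers r ≥ 2, 1 ≤ i ≤ r, and n ≥ 0, the number of partitions of n into parts not congruent to 0, i, or −i modulo 2r+1 equals the number of partitions of n that satisfy the Gordon difference condition for r and have at most i − 1 parts equal to 1. -/

import Mathlib

open PowerSeries Finset

/-- Gordon difference condition for `r`: for every `a ≥ 1`, at most `r - 1` of the parts
lie in `{a, a+1}` (equivalent to `λ_m - λ_{m+r-1} ≥ 2` for all valid `m`). -/
def GordonCond (r : ℕ) {n : ℕ} (p : Nat.Partition n) : Prop :=
  ∀ a : ℕ, 1 ≤ a → Multiset.count a p.parts + Multiset.count (a+1) p.parts ≤ r - 1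

/-- `B_{r,i,J}(n)`: number of partitions of `n` satisfying the Gordon difference condition
for `r`, with all parts `> J` and at most `i - 1` parts equal to `J + 1`. -/
noncomputable def BCount (r i J n : ℕ) : ℕ :=
  Nat.card {p : Nat.Partition n // GordonCond r p ∧ (∀ x ∈ p.parts, J < x) ∧
    Multiset.count (J+1) p.parts ≤ i - 1}

/-- Number of partitions of `n` into parts not congruent to `0`, `c`, or `-c` modulo `2r+1`. -/
noncomputable def ACountMod (r c n : ℕ) : ℕ :=
  Nat.card {p : Nat.Partition n // ∀ x ∈ p.parts,
    (x : ZMod (2*r+1)) ≠ 0 ∧ (x : ZMod (2*r+1)) ≠ (c : ZMod (2*r+1)) ∧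
      (x : ZMod (2*r+1)) ≠ -(c : ZMod (2*r+1))}

section QBinomial

variable {S : Type*} [CommRing S]

/-- The Gaussian binomial coefficient `[n + k choose k]` evaluated at `q`. -/
def gaussBinom (q : S) : ℕ → ℕ → S
  | _, 0 => 1
  | 0, _ + 1 => 1
  | n + 1, k + 1 => gaussBinom q (n + 1) k + q ^ (k + 1) * gaussBinom q n (k + 1)

@[simp] lemma gaussBinom_zero_right (q : S) (n : ℕ) : gaussBinom q n 0 = 1 := by
  cases n <;> simp [gaussBinom]

@[simp] lemma gaussBinom_zero_left (q : S) (k : ℕ) : gaussBinom q 0 k = 1 := by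
  cases k <;> simp [gaussBinom]

lemma gaussBinom_succ_succ (q : S) (n k : ℕ) :
    gaussBinom q (n + 1) (k + 1) =
      gaussBinom q (n + 1) k + q ^ (k + 1) * gaussBinom q n (k + 1) := by
  rw [gaussBinom]

lemma one_sub_mul_gaussBinom_aux (q : S) (n : ℕ)
    (h : ∀ k, (1 - q ^ (k + 1)) * gaussBinom q n (k + 1) =
      (1 - q ^ (n + k + 1)) * gaussBinom q n k) (k : ℕ) :
    (1 - q ^ (n + 1)) * gaussBinom q (n + 1) k =
      (1 - q ^ (n + k + 1)) * gaussBinom q n k := by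
  induction k with
  | zero => simp
  | succ k ih =>
    rw [gaussBinom_succ_succ]
    linear_combination ih - h k

/-- Raising the second index of a Gaussian binomial coefficient. -/
lemma one_sub_mul_gaussBinom_succ_right (q : S) (n k : ℕ) :
    (1 - q ^ (k + 1)) * gaussBinom q n (k + 1) =
      (1 - q ^ (n + k + 1)) * gaussBinom q n k := by
  induction n generalizing k with
  | zero => simp
  | succ n ih =>
    rw [gaussBinom_succ_succ]
    linear_combination q ^ (k + 1) * ih k -
      q ^ (k + 1) * one_sub_mul_gaussBinom_aux q n ih k

/-- Raising the first index of a Gaussian binomial coefficient. -/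
lemma one_sub_mul_gaussBinom_succ_left (q : S) (n k : ℕ) :
    (1 - q ^ (n + 1)) * gaussBinom q (n + 1) k =
      (1 - q ^ (n + k + 1)) * gaussBinom q n k :=
  one_sub_mul_gaussBinom_aux q n (one_sub_mul_gaussBinom_succ_right q n) k

lemma gaussBinom_comm (q : S) (n k : ℕ) : gaussBinom q n k = gaussBinom q k n := by
  induction n generalizing k with
  | zero => simp
  | succ n ihn =>
    induction k with
    | zero => simp
    | succ k ihk =>
      rw [gaussBinom_succ_succ, gaussBinom_succ_succ q k n, ← ihk, ← ihn (k + 1)]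
      linear_combination one_sub_mul_gaussBinom_succ_left q n k -
        one_sub_mul_gaussBinom_succ_right q n k

lemma gaussBinom_mul_prod (q : S) (n k : ℕ) :
    gaussBinom q n k * ∏ m ∈ range n, (1 - q ^ (m + 1)) =
      ∏ m ∈ range n, (1 - q ^ (m + k + 1)) := by
  induction n with
  | zero => simp
  | succ n ih =>
    rw [prod_range_succ, prod_range_succ, ← ih]
    linear_combination (∏ m ∈ range n, (1 - q ^ (m + 1))) *
      one_sub_mul_gaussBinom_succ_left q n k

lemma dvd_prod_sub_one {ι : Type*} (d : S) (s : Finset ι) (f : ι → S)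
    (h : ∀ m ∈ s, d ∣ f m - 1) : d ∣ ∏ m ∈ s, f m - 1 := by
  classical
  induction s using Finset.induction_on with
  | empty => simp
  | insert a s ha ih =>
    rw [prod_insert ha]
    have h1 := h a (mem_insert_self a s)
    have h2 := ih fun m hm => h m (mem_insert_of_mem hm)
    have : f a * ∏ m ∈ s, f m - 1 = f a * (∏ m ∈ s, f m - 1) + (f a - 1) := by ring
    rw [this]
    exact dvd_add (h2.mul_left _) h1

/-- The product of a Gaussian binomial coefficient with `(q; q)_N` is `1` up to high order. -/
lemma pow_dvd_gaussBinom_mul_prod_sub_one (q : S) {n k N : ℕ} (hnk : n ≤ k) (hN : n ≤ N) :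
    q ^ (n + 1) ∣ gaussBinom q n k * ∏ m ∈ range N, (1 - q ^ (m + 1)) - 1 := by
  obtain ⟨t, rfl⟩ := Nat.exists_eq_add_of_le hN
  have key : ∀ (a : ℕ) (f : ℕ → ℕ), (∀ m, n + 1 ≤ f m) →
      q ^ (n + 1) ∣ ∏ m ∈ range a, (1 - q ^ f m) - 1 := by
    intro a f hf
    refine dvd_prod_sub_one _ _ _ fun m _ => ?_
    have : 1 - q ^ f m - 1 = -q ^ f m := by ring
    rw [this, dvd_neg]
    exact pow_dvd_pow q (hf m)
  rw [prod_range_add, ← mul_assoc, gaussBinom_mul_prod]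
  have h1 := key n (fun m => m + k + 1) (fun m => by omega)
  have h2 := key t (fun m => n + m + 1) (fun m => by omega)
  set A := ∏ m ∈ range n, (1 - q ^ (m + k + 1))
  set B := ∏ m ∈ range t, (1 - q ^ (n + m + 1))
  have : A * B - 1 = A * (B - 1) + (A - 1) := by ring
  rw [this]
  exact dvd_add (h2.mul_left _) h1

lemma choose_two_succ (n : ℕ) : (n + 1).choose 2 = n.choose 2 + n := by
  rw [Nat.choose_succ_succ' n 1, Nat.choose_one_right, add_comm]

/-- The `q`-binomial theorem. -/
theorem prod_add_mul_pow_eq_sum_gaussBinom (q a b : S) (L : ℕ) :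
    ∏ m ∈ range L, (a + b * q ^ m) =
      ∑ k ∈ range (L + 1), gaussBinom q (L - k) k * q ^ k.choose 2 * a ^ (L - k) * b ^ k := by
  induction L generalizing b with
  | zero => simp
  | succ L ih =>
    have h : ∏ m ∈ range L, (a + b * q ^ (m + 1)) =
        ∏ m ∈ range L, (a + (b * q) * q ^ m) :=
      prod_congr rfl fun m _ => by ring
    rw [prod_range_succ', h, ih, mul_add, sum_mul, sum_mul]
    rw [sum_range_succ' _ (L + 1), sum_range_succ' _ L, sum_range_succ _ L,
      sum_range_succ _ L]
    have h2 : ∀ k ∈ range L,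
        gaussBinom q (L + 1 - (k + 1)) (k + 1) * q ^ (k + 1).choose 2 *
          a ^ (L + 1 - (k + 1)) * b ^ (k + 1) =
        gaussBinom q (L - (k + 1)) (k + 1) * q ^ (k + 1).choose 2 * a ^ (L - (k + 1)) *
          (b * q) ^ (k + 1) * a +
        gaussBinom q (L - k) k * q ^ k.choose 2 * a ^ (L - k) * (b * q) ^ k * (b * q ^ 0) := by
      intro k hk
      obtain ⟨t, rfl⟩ := Nat.exists_eq_add_of_lt (mem_range.mp hk)
      rw [show k + t + 1 + 1 - (k + 1) = t + 1 by omega,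
        show k + t + 1 - (k + 1) = t by omega, show k + t + 1 - k = t + 1 by omega,
        gaussBinom_succ_succ, choose_two_succ]
      ring
    rw [sum_congr rfl h2, sum_add_distrib]
    simp only [Nat.sub_self, gaussBinom_zero_left, choose_two_succ, gaussBinom_zero_right,
      Nat.sub_zero, Nat.choose_zero_succ, pow_zero]
    ring

lemma choose_two_add (m n : ℕ) :
    (m + n).choose 2 = m.choose 2 + n.choose 2 + m * n := by
  induction n with
  | zero => simp
  | succ n ih => rw [← add_assoc, choose_two_succ, ih, choose_two_succ]; ring

/-- A finite form of the Jacobi triple product identity. -/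
theorem finite_jacobi_triple_product [IsDomain S] {x : S} (hx : x ≠ 0) (i d N : ℕ) :
    (∏ m ∈ range N, (1 - x ^ ((i + d) * m + i))) * ∏ m ∈ range N, (1 - x ^ ((i + d) * m + d)) =
      ∑ t ∈ range (N + 1), (-1) ^ t * x ^ ((i + d) * t.choose 2 + i * t) *
          gaussBinom (x ^ (i + d)) (N - t) (N + t) +
        ∑ t ∈ range N, (-1) ^ (t + 1) * x ^ ((i + d) * (t + 1).choose 2 + d * (t + 1)) *
          gaussBinom (x ^ (i + d)) (N - (t + 1)) (N + (t + 1)) := by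
  have hq := prod_add_mul_pow_eq_sum_gaussBinom (x ^ (i + d)) (x ^ ((i + d) * N)) (-x ^ i) (2 * N)
  have hfirst : ∏ m ∈ range N, (x ^ ((i + d) * N) + -x ^ i * (x ^ (i + d)) ^ m) =
      (-1) ^ N * x ^ ((i + d) * N.choose 2 + i * N) *
        ∏ m ∈ range N, (1 - x ^ ((i + d) * m + d)) := by
    have h1 : ∀ m ∈ range N, x ^ ((i + d) * N) + -x ^ i * (x ^ (i + d)) ^ m =
        (-1) * (x ^ i * ((x ^ (i + d)) ^ m)) * (1 - x ^ ((i + d) * (N - 1 - m) + d)) := by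
      intro m hm
      obtain ⟨t, rfl⟩ := Nat.exists_eq_add_of_lt (mem_range.mp hm)
      rw [show m + t + 1 - 1 - m = t by omega]
      ring
    rw [prod_congr rfl h1, prod_mul_distrib, prod_mul_distrib, prod_mul_distrib,
      prod_range_reflect (fun m => 1 - x ^ ((i + d) * m + d)) N, prod_const, prod_const,
      prod_pow_eq_pow_sum, card_range, Finset.sum_range_id, ← Nat.choose_two_right]
    ring
  have hsecond : ∏ m ∈ range N, (x ^ ((i + d) * N) + -x ^ i * (x ^ (i + d)) ^ (N + m)) =
      x ^ ((i + d) * N * N) * ∏ m ∈ range N, (1 - x ^ ((i + d) * m + i)) := by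
    have h1 : ∀ m ∈ range N, x ^ ((i + d) * N) + -x ^ i * (x ^ (i + d)) ^ (N + m) =
        x ^ ((i + d) * N) * (1 - x ^ ((i + d) * m + i)) := by
      intro m _
      ring
    rw [prod_congr rfl h1, prod_mul_distrib, prod_const, card_range]
    ring
  rw [show 2 * N = N + N by ring, prod_range_add, hfirst, hsecond] at hq
  rw [show N + N + 1 = N + (N + 1) by ring, sum_range_add] at hq
  rw [← sum_range_reflect _ N] at hq
  have hlow : ∀ t ∈ range N, gaussBinom (x ^ (i + d)) (N + N - (N - 1 - t)) (N - 1 - t) *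
        (x ^ (i + d)) ^ (N - 1 - t).choose 2 * (x ^ ((i + d) * N)) ^ (N + N - (N - 1 - t)) *
        (-x ^ i) ^ (N - 1 - t) =
      ((-1) ^ N * x ^ ((i + d) * N.choose 2 + i * N) * x ^ ((i + d) * N * N)) *
      ((-1) ^ (t + 1) * x ^ ((i + d) * (t + 1).choose 2 + d * (t + 1)) *
          gaussBinom (x ^ (i + d)) (N - (t + 1)) (N + (t + 1))) := by
    intro t ht
    obtain ⟨s, rfl⟩ := Nat.exists_eq_add_of_lt (mem_range.mp ht)
    rw [show t + s + 1 + (t + s + 1) - (t + s + 1 - 1 - t) = t + s + 1 + (t + 1) by omega,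
      show t + s + 1 - 1 - t = s by omega, show t + s + 1 - (t + 1) = s by omega,
      gaussBinom_comm]
    rw [show t + s + 1 = s + (t + 1) by ring, choose_two_add s (t + 1), neg_pow (x ^ i)]
    have hs : (-1 : S) ^ (s + (t + 1)) * (-1) ^ (t + 1) = (-1) ^ s := by
      rw [pow_add, mul_assoc, ← mul_pow]; simp
    rw [← hs]
    have hc : (t + 1) * (t + 1) = 2 * (t + 1).choose 2 + (t + 1) := by
      rw [choose_two_succ, Nat.choose_two_right]
      have := Nat.even_mul_pred_self t |>.two_dvd
      have := Nat.div_mul_cancel this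
      cases t <;> grind
    set c := (t + 1).choose 2
    have he : (i + d) * s.choose 2 + (i + d) * (s + (t + 1)) * (s + (t + 1) + (t + 1)) + i * s =
       (i + d) * (s.choose 2 + c + s * (t + 1)) + i * (s + (t + 1)) +
        (i + d) * (s + (t + 1)) * (s + (t + 1)) + ((i + d) * c + d * (t + 1)) := by
      linear_combination (i + d) * hc
    have he2 := congrArg (fun e => x ^ e) he
    simp only [pow_add x] at he2
    simp only [← pow_mul, pow_add x]
    linear_combination (gaussBinom (x ^ i * x ^ d) s (s + (t + 1) + (t + 1))) *
      ((-1 : S) ^ (s + (t + 1)) * (-1) ^ (t + 1)) * he2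
  have hhigh : ∀ t ∈ range (N + 1), gaussBinom (x ^ (i + d)) (N + N - (N + t)) (N + t) *
        (x ^ (i + d)) ^ (N + t).choose 2 * (x ^ ((i + d) * N)) ^ (N + N - (N + t)) *
        (-x ^ i) ^ (N + t) =
      ((-1) ^ N * x ^ ((i + d) * N.choose 2 + i * N) * x ^ ((i + d) * N * N)) *
      ((-1) ^ t * x ^ ((i + d) * t.choose 2 + i * t) *
          gaussBinom (x ^ (i + d)) (N - t) (N + t)) := by
    intro t ht
    obtain ⟨s, rfl⟩ := Nat.exists_eq_add_of_le (mem_range_succ_iff.mp ht)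
    rw [show t + s + (t + s) - (t + s + t) = s by omega,
      show t + s - t = s by omega, choose_two_add (t + s) t, neg_pow (x ^ i)]
    generalize gaussBinom (x ^ (i + d)) s (t + s + t) = g
    generalize (t + s).choose 2 = c
    ring
  rw [sum_congr rfl hlow, sum_congr rfl hhigh, ← mul_sum, ← mul_sum, ← mul_add] at hq
  have hne : (-1) ^ N * x ^ ((i + d) * N.choose 2 + i * N) * x ^ ((i + d) * N * N) ≠ 0 :=
    mul_ne_zero (mul_ne_zero (pow_ne_zero _ (neg_ne_zero.mpr one_ne_zero)) (pow_ne_zero _ hx))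
      (pow_ne_zero _ hx)
  apply mul_left_cancel₀ hne
  linear_combination hq

end QBinomial

section AndrewsSum

variable {S : Type*} [CommRing S]

/-- The `n`-th term of Andrews' series `J_{r,i}(q ^ J; q)`, multiplied by `(q ^ (J + 1); q)_∞`. -/
def andrewsTerm (q : S) (r i J n : ℕ) : S :=
  (-1) ^ n * (q ^ (J * (r * n) + (2 * r + 1) * n.choose 2 + (2 * r + 1 - i) * n) -
    q ^ (J * (r * n) + (2 * r + 1) * (n.choose 2 + n) + i * (J + n + 1))) * gaussBinom q n J

/-- The sum of the first `L` terms of Andrews' series `J_{r,i}(q ^ J; q)`, multiplied by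
`(q ^ (J + 1); q)_∞`. -/
def andrewsSum (q : S) (r i J L : ℕ) : S :=
  ∑ n ∈ range L, andrewsTerm q r i J n

lemma andrewsSum_zero (q : S) (r J L : ℕ) : andrewsSum q r 0 J L = 0 := by
  refine sum_eq_zero fun n _ => ?_
  have : (2 * r + 1) * n.choose 2 + (2 * r + 1 - 0) * n =
      (2 * r + 1) * (n.choose 2 + n) + 0 * (J + n + 1) := by
    simp; ring
  rw [andrewsTerm, add_assoc, this, ← add_assoc]
  simp

lemma andrewsTerm_succ_sub (q : S) {r i : ℕ} (hi : i < r) (J n : ℕ) :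
    andrewsTerm q r (i + 1) J n - andrewsTerm q r i J n =
      (1 - q ^ (J + 1)) * q ^ ((J + 1) * i) * andrewsTerm q r (r - i) (J + 1) n -
      ((-1) ^ (n + 1) * q ^ (J * (r * (n + 1)) + (2 * r + 1) * (n + 1).choose 2 +
          (2 * r - i) * (n + 1)) * (1 - q ^ (n + 1)) * gaussBinom q (n + 1) J -
        (-1) ^ n * q ^ (J * (r * n) + (2 * r + 1) * n.choose 2 + (2 * r - i) * n) *
          (1 - q ^ n) * gaussBinom q n J) := by
  obtain ⟨l, rfl⟩ := Nat.exists_eq_add_of_lt hi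
  have e1 := one_sub_mul_gaussBinom_succ_right q n J
  have e2 := one_sub_mul_gaussBinom_succ_left q n J
  simp only [andrewsTerm, choose_two_succ]
  rw [show 2 * (i + l + 1) + 1 - (i + 1) = i + 2 * l + 2 by omega,
    show 2 * (i + l + 1) + 1 - i = i + 2 * l + 3 by omega,
    show 2 * (i + l + 1) - i = i + 2 * l + 2 by omega,
    show i + l + 1 - i = l + 1 by omega,
    show 2 * (i + l + 1) + 1 - (l + 1) = 2 * i + l + 2 by omega]
  generalize n.choose 2 = c at *
  linear_combination
    (-1 : S) ^ n * q ^ ((J + 1) * i) * (q ^ ((J + 1) * ((i + l + 1) * n) +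
        (2 * (i + l + 1) + 1) * c + (2 * i + l + 2) * n) -
      q ^ ((J + 1) * ((i + l + 1) * n) + (2 * (i + l + 1) + 1) * (c + n) +
        (l + 1) * (J + 1 + n + 1))) * (-e1) +
    (-1 : S) ^ (n + 1) * q ^ (J * ((i + l + 1) * (n + 1)) + (2 * (i + l + 1) + 1) * (c + n) +
        (i + 2 * l + 2) * (n + 1)) * e2

lemma le_choose_two_succ (N : ℕ) : N ≤ (N + 1).choose 2 := by
  rw [choose_two_succ]; omega

/-- Andrews' recurrence. -/
lemma andrewsSum_succ {q : S} {r i N : ℕ} (hi : i < r) (J : ℕ)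
    (hq : q ^ ((2 * r + 1) * N) = 0) :
    andrewsSum q r (i + 1) J (N + 1) = andrewsSum q r i J (N + 1) +
      (1 - q ^ (J + 1)) * q ^ ((J + 1) * i) * andrewsSum q r (r - i) (J + 1) (N + 1) := by
  have h := sum_congr (rfl : range (N + 1) = range (N + 1))
    fun n _ => andrewsTerm_succ_sub q hi J n
  rw [sum_sub_distrib, sum_sub_distrib, ← mul_sum,
    sum_range_sub fun n => (-1) ^ n * q ^ (J * (r * n) + (2 * r + 1) * n.choose 2 +
      (2 * r - i) * n) * (1 - q ^ n) * gaussBinom q n J] at h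
  have hz : q ^ (J * (r * (N + 1)) + (2 * r + 1) * (N + 1).choose 2 +
      (2 * r - i) * (N + 1)) = 0 := by
    refine pow_eq_zero_of_le ?_ hq
    have := Nat.mul_le_mul_left (2 * r + 1) (le_choose_two_succ N)
    omega
  rw [hz] at h
  simp only [andrewsSum]
  linear_combination h

lemma andrewsSum_eq_one {q : S} {r i N : ℕ} (hr : 0 < r) (hi : 0 < i)
    (hq : q ^ ((2 * r + 1) * N) = 0) :
    andrewsSum q r i ((2 * r + 1) * N) (N + 1) = 1 := by
  rw [andrewsSum, sum_range_succ', sum_eq_zero]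
  · have : q ^ (i * ((2 * r + 1) * N + 1)) = 0 :=
      pow_eq_zero_of_le ((Nat.le_succ _).trans (Nat.le_mul_of_pos_left _ hi)) hq
    simp [andrewsTerm, this]
  · intro n _
    have hle : (2 * r + 1) * N ≤ (2 * r + 1) * N * (r * (n + 1)) :=
      Nat.le_mul_of_pos_right _ (by positivity)
    rw [andrewsTerm, pow_eq_zero_of_le (by omega) hq, pow_eq_zero_of_le (by omega) hq]
    simp

/-- A truncated form of the Jacobi triple product identity, for the series `J_{r,i}(1; q)`. -/
lemma map_jacobi_triple_product {S' : Type*} [CommRing S'] [IsDomain S'] (φ : S' →+* S) {x : S'}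
    (hx : x ≠ 0) {r i N : ℕ} (hir : i ≤ r) (hq : φ x ^ ((2 * r + 1) * N) = 0) :
    (∏ m ∈ range N, (1 - φ x ^ ((2 * r + 1) * (m + 1)))) *
      (∏ m ∈ range N, (1 - φ x ^ ((2 * r + 1) * m + (2 * r + 1 - i)))) *
      ∏ m ∈ range N, (1 - φ x ^ ((2 * r + 1) * m + i)) = andrewsSum (φ x) r i 0 (N + 1) := by
  obtain ⟨d, hd⟩ := Nat.exists_eq_add_of_le (show i ≤ 2 * r + 1 by omega)
  rw [andrewsSum]
  simp only [andrewsTerm]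
  rw [hd, Nat.add_sub_cancel_left]
  rw [hd] at hq
  set y := φ x
  have hJ := congrArg φ (finite_jacobi_triple_product hx d i N)
  rw [add_comm d i] at hJ
  have hgauss : ∀ n k, φ (gaussBinom (x ^ (i + d)) n k) = gaussBinom (y ^ (i + d)) n k := by
    intro n
    induction n with
    | zero => simp
    | succ n ihn =>
      intro k
      induction k with
      | zero => simp
      | succ k ihk => simp [gaussBinom_succ_succ, ihn, ihk, y]
  simp only [map_mul, map_add, map_sub, map_sum, map_prod, map_one, map_pow, map_neg, hgauss]
    at hJ
  change _ = ∑ t ∈ _, (-1) ^ t * y ^ _ * _ + ∑ t ∈ _, (-1) ^ (t + 1) * y ^ _ * _ at hJ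
  rw [mul_assoc, show (∏ m ∈ range N, (1 - y ^ ((i + d) * m + d))) *
    (∏ m ∈ range N, (1 - y ^ ((i + d) * m + i))) = _ from hJ, mul_add, mul_sum, mul_sum]
  simp only [pow_mul y (i + d) (_ + 1)]
  have hterm : ∀ t e, t ≤ N → (i + d) * N ≤ e + (i + d) * (N - t + 1) →
      (∏ m ∈ range N, (1 - (y ^ (i + d)) ^ (m + 1))) *
        ((-1) ^ t * y ^ e * gaussBinom (y ^ (i + d)) (N - t) (N + t)) = (-1) ^ t * y ^ e := by
    intro t e ht he
    obtain ⟨w, hw⟩ := pow_dvd_gaussBinom_mul_prod_sub_one (y ^ (i + d))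
      (show N - t ≤ N + t by omega) (Nat.sub_le N t)
    have hz : y ^ e * (y ^ (i + d)) ^ (N - t + 1) = 0 := by
      rw [← pow_mul, ← pow_add]
      exact pow_eq_zero_of_le he hq
    linear_combination (-1) ^ t * y ^ e * hw + (-1) ^ t * w * hz
  have hc : ∀ t, t ≤ t.choose 2 + 1 := by
    intro t
    cases t with
    | zero => simp
    | succ t => have := le_choose_two_succ t; omega
  have hbound : ∀ t ≤ N, (i + d) * N ≤ (i + d) * t.choose 2 + (i + d) * (N - t + 1) := by
    intro t ht
    rw [← mul_add]
    have := hc t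
    exact Nat.mul_le_mul_left _ (by omega)
  rw [sum_congr rfl fun t ht => hterm t _ (mem_range_succ_iff.mp ht) (by
      have := hbound t (mem_range_succ_iff.mp ht); omega),
    sum_congr rfl fun t ht => hterm (t + 1) _ (mem_range.mp ht) (by
      have := hbound (t + 1) (mem_range.mp ht); omega)]
  have hlast : y ^ ((i + d) * (N.choose 2 + N) + i * (N + 1)) = 0 :=
    pow_eq_zero_of_le (by rw [mul_add]; omega) hq
  simp only [gaussBinom_zero_right, mul_one, zero_mul, zero_add, mul_sub, sum_sub_distrib]
  rw [sum_range_succ (fun t => (-1) ^ t * y ^ ((i + d) * (t.choose 2 + t) + i * (t + 1))) N,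
    hlast, mul_zero, add_zero, sub_eq_add_neg, ← sum_neg_distrib]
  congr 1
  refine sum_congr rfl fun t _ => ?_
  rw [choose_two_succ]
  ring

end AndrewsSum

section PartitionGenFun

/-- The generating function of the partitions whose multiset of parts satisfies `P`. -/
noncomputable def partitionGenFun (P : Multiset ℕ → Prop) : ℤ⟦X⟧ :=
  PowerSeries.mk fun n => (Nat.card {p : Nat.Partition n // P p.parts} : ℤ)

lemma coeff_partitionGenFun (P : Multiset ℕ → Prop) (n : ℕ) :
    coeff n (partitionGenFun P) = (Nat.card {p : Nat.Partition n // P p.parts} : ℤ) :=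
  coeff_mk _ _

lemma partitionGenFun_eq_add {P A B : Multiset ℕ → Prop} (h : ∀ s, P s ↔ A s ∨ B s)
    (hAB : ∀ s, A s → ¬ B s) : partitionGenFun P = partitionGenFun A + partitionGenFun B := by
  classical
  ext n
  simp only [map_add, coeff_partitionGenFun, Nat.card_eq_fintype_card, Fintype.card_subtype, h,
    filter_or]
  rw [card_union_of_disjoint]
  · push_cast; rfl
  · rw [disjoint_filter]
    exact fun p _ => hAB p.parts

lemma partitionGenFun_eq_X_pow_mul {P P' : Multiset ℕ → Prop} {a : ℕ} (ha : 0 < a) (k : ℕ)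
    (h1 : ∀ t, P' t → P (t + Multiset.replicate k a))
    (h2 : ∀ s, P s → Multiset.replicate k a ≤ s ∧ P' (s - Multiset.replicate k a)) :
    partitionGenFun P = X ^ (a * k) * partitionGenFun P' := by
  ext n
  rw [coeff_X_pow_mul', coeff_partitionGenFun]
  split_ifs with hn
  · rw [coeff_partitionGenFun, Nat.cast_inj]
    symm
    let f : {p : Nat.Partition (n - a * k) // P' p.parts} → {p : Nat.Partition n // P p.parts} :=
      fun p => ⟨⟨p.1.parts + Multiset.replicate k a, by
        intro x hx
        rcases Multiset.mem_add.mp hx with hx | hx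
        · exact p.1.parts_pos hx
        · rwa [Multiset.eq_of_mem_replicate hx], by
        rw [Multiset.sum_add, p.1.parts_sum, Multiset.sum_replicate, smul_eq_mul, mul_comm k a]
        omega⟩, h1 _ p.2⟩
    refine Nat.card_eq_of_bijective f ⟨fun p p' hpp => ?_, fun p => ?_⟩
    · have := congrArg (fun q => q.1.parts) hpp
      exact Subtype.ext (Nat.Partition.ext (add_right_cancel this))
    · obtain ⟨hle, hp⟩ := h2 _ p.2
      have hadd := tsub_add_cancel_of_le hle
      refine ⟨⟨⟨p.1.parts - Multiset.replicate k a, fun hx =>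
        p.1.parts_pos (Multiset.mem_of_le (Multiset.sub_le_self _ _) hx), ?_⟩, hp⟩,
        Subtype.ext (Nat.Partition.ext hadd)⟩
      have hsum := congrArg Multiset.sum hadd
      rw [Multiset.sum_add, p.1.parts_sum, Multiset.sum_replicate, smul_eq_mul, mul_comm k a]
        at hsum
      omega
  · rw [Nat.cast_eq_zero]
    refine Finite.card_eq_zero_iff.mpr ⟨fun p => hn ?_⟩
    have hsum := congrArg Multiset.sum (tsub_add_cancel_of_le (h2 _ p.2).1)
    rw [Multiset.sum_add, p.1.parts_sum, Multiset.sum_replicate, smul_eq_mul, mul_comm k a]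
      at hsum
    omega

lemma map_partitionGenFun_eq_one {S : Type*} [CommRing S] (φ : ℤ⟦X⟧ →+* S) {K : ℕ}
    (hK : φ X ^ K = 0) {P : Multiset ℕ → Prop} (h0 : P 0) (hP : ∀ s, P s → ∀ x ∈ s, K < x) :
    φ (partitionGenFun P) = 1 := by
  have hdvd : X ^ K ∣ partitionGenFun P - 1 := by
    rw [X_pow_dvd_iff]
    intro n hn
    rw [map_sub, coeff_partitionGenFun, coeff_one]
    split_ifs with hn0
    · subst hn0
      have : Nat.card {p : Nat.Partition 0 // P p.parts} = 1 := by
        rw [Nat.card_eq_one_iff_unique]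
        exact ⟨inferInstance, ⟨⟨default, by simpa using h0⟩⟩⟩
      rw [this, Nat.cast_one, sub_self]
    · have : Nat.card {p : Nat.Partition n // P p.parts} = 0 := by
        refine Finite.card_eq_zero_iff.mpr ⟨fun p => hn0 ?_⟩
        have hparts : p.1.parts = 0 := Multiset.eq_zero_of_forall_notMem fun x hx => by
          have := hP _ p.2 x hx
          have := p.1.le_of_mem_parts hx
          omega
        rw [← p.1.parts_sum, hparts, Multiset.sum_zero]
      rw [this, Nat.cast_zero, sub_zero]
  obtain ⟨w, hw⟩ := hdvd
  have := congrArg φ hw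
  rw [map_sub, map_one, map_mul, map_pow, hK, zero_mul] at this
  exact sub_eq_zero.mp this

lemma one_sub_X_pow_mul_partitionGenFun {p : ℕ → Prop} {J : ℕ} (hp : p (J + 1)) :
    (1 - X ^ (J + 1)) * partitionGenFun (fun s => ∀ x ∈ s, J < x ∧ p x) =
      partitionGenFun (fun s => ∀ x ∈ s, J + 1 < x ∧ p x) := by
  have h := partitionGenFun_eq_add
    (P := fun s => ∀ x ∈ s, J < x ∧ p x)
    (A := fun s => ∀ x ∈ s, J + 1 < x ∧ p x)
    (B := fun s => (J + 1) ∈ s ∧ ∀ x ∈ s, J < x ∧ p x)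
    (fun s => by
      refine ⟨fun hs => ?_, ?_⟩
      · by_cases hJ : J + 1 ∈ s
        · exact Or.inr ⟨hJ, hs⟩
        · refine Or.inl fun x hx => ⟨?_, (hs x hx).2⟩
          have := (hs x hx).1
          have : x ≠ J + 1 := fun h => hJ (h ▸ hx)
          omega
      · rintro (hs | hs)
        · exact fun x hx => ⟨(Nat.lt_succ_self J).trans (hs x hx).1, (hs x hx).2⟩
        · exact hs.2)
    (fun s hs hs' => (hs _ hs'.1).1.false)
  have h' := partitionGenFun_eq_X_pow_mul
    (P := fun s => (J + 1) ∈ s ∧ ∀ x ∈ s, J < x ∧ p x)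
    (P' := fun s => ∀ x ∈ s, J < x ∧ p x) (Nat.succ_pos J) 1
    (fun t ht => by
      refine ⟨by simp, fun x hx => ?_⟩
      rcases Multiset.mem_add.mp hx with hx | hx
      · exact ht x hx
      · rw [Multiset.eq_of_mem_replicate hx]
        exact ⟨Nat.lt_succ_self J, hp⟩)
    (fun s hs => ⟨by simpa using hs.1,
      fun x hx => hs.2 x (Multiset.mem_of_le (Multiset.sub_le_self _ _) hx)⟩)
  rw [mul_one, Nat.succ_eq_add_one] at h'
  linear_combination h + h'

lemma partitionGenFun_of_not {p : ℕ → Prop} {J : ℕ} (hp : ¬ p (J + 1)) :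
    partitionGenFun (fun s => ∀ x ∈ s, J < x ∧ p x) =
      partitionGenFun (fun s => ∀ x ∈ s, J + 1 < x ∧ p x) := by
  congr 1
  funext s
  refine propext (forall₂_congr fun x _ => and_congr_left fun hx => ?_)
  have : x ≠ J + 1 := fun h => hp (h ▸ hx)
  omega

lemma map_partitionGenFun_mul_prod {S : Type*} [CommRing S] (φ : ℤ⟦X⟧ →+* S) {K : ℕ}
    (hK : φ X ^ K = 0) (p : ℕ → Prop) [DecidablePred p] {J : ℕ} (hJ : J ≤ K) :
    φ (partitionGenFun fun s => ∀ x ∈ s, J < x ∧ p x) *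
      ∏ m ∈ Ico J K, (if p (m + 1) then 1 - φ X ^ (m + 1) else 1) = 1 := by
  induction hJ using Nat.decreasingInduction with
  | self =>
    rw [map_partitionGenFun_eq_one φ hK (by simp) fun s hs x hx => (hs x hx).1]
    simp
  | of_succ J hJ ih =>
    rw [prod_eq_prod_Ico_succ_bot hJ]
    refine Eq.trans ?_ ih
    split_ifs with hp
    · rw [← one_sub_X_pow_mul_partitionGenFun hp]
      simp only [map_mul, map_sub, map_one, map_pow]
      ring
    · rw [partitionGenFun_of_not hp, one_mul]

/-- The multisets counted by `BCount r (k + 1) J`. -/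
def GordonParts (r k J : ℕ) (s : Multiset ℕ) : Prop :=
  (∀ a : ℕ, 1 ≤ a → Multiset.count a s + Multiset.count (a + 1) s ≤ r - 1) ∧
    (∀ x ∈ s, J < x) ∧ Multiset.count (J + 1) s ≤ k

lemma partitionGenFun_gordonParts_count_eq {r k : ℕ} (hk : k < r) (J : ℕ) :
    partitionGenFun (fun s => GordonParts r k J s ∧ Multiset.count (J + 1) s = k) =
      X ^ ((J + 1) * k) * partitionGenFun (GordonParts r (r - 1 - k) (J + 1)) := by
  refine partitionGenFun_eq_X_pow_mul (Nat.succ_pos J) k ?_ ?_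
  · rintro t ⟨h1, h2, h3⟩
    have hnot : ∀ a ≤ J + 1, Multiset.count a t = 0 := fun a ha =>
      Multiset.count_eq_zero_of_notMem fun h => by have := h2 a h; omega
    refine ⟨⟨fun a ha => ?_, fun x hx => ?_, ?_⟩, ?_⟩
    · simp only [Multiset.count_add, Multiset.count_replicate]
      have := h1 a ha
      rcases lt_trichotomy a (J + 1) with h | h | h
      · have := hnot a h.le
        have := hnot (a + 1) h
        split_ifs <;> omega
      · subst h
        have := hnot (J + 1) le_rfl
        rw [if_pos rfl, if_neg (by omega)]
        omega
      · rw [if_neg (by omega), if_neg (by omega)]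
        omega
    · rcases Multiset.mem_add.mp hx with hx | hx
      · exact (Nat.lt_succ_self J).trans (h2 x hx)
      · rw [Multiset.eq_of_mem_replicate hx]
        exact Nat.lt_succ_self J
    · simp [hnot (J + 1) le_rfl]
    · simp [hnot (J + 1) le_rfl]
  · rintro s ⟨⟨h1, h2, h3⟩, h4⟩
    refine ⟨Multiset.le_count_iff_replicate_le.mp h4.ge, fun a ha => ?_, fun x hx => ?_, ?_⟩
    · simp only [Multiset.count_sub]
      have := h1 a ha
      omega
    · have := h2 x (Multiset.mem_of_le (Multiset.sub_le_self _ _) hx)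
      have : x ≠ J + 1 := by
        rintro rfl
        rw [← Multiset.count_pos, Multiset.count_sub, Multiset.count_replicate_self] at hx
        omega
      omega
    · rw [Multiset.count_sub, Multiset.count_replicate, if_neg (by omega)]
      have := h1 (J + 1) (by omega)
      omega

lemma partitionGenFun_gordonParts_zero {r : ℕ} (hr : 0 < r) (J : ℕ) :
    partitionGenFun (GordonParts r 0 J) = partitionGenFun (GordonParts r (r - 1) (J + 1)) := by
  have h := partitionGenFun_gordonParts_count_eq hr J
  rw [mul_zero, pow_zero, one_mul, Nat.sub_zero] at h
  rw [← h]
  congr 1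
  funext s
  exact propext ⟨fun hs => ⟨hs, Nat.le_zero.mp hs.2.2⟩, And.left⟩

lemma partitionGenFun_gordonParts_succ {r k : ℕ} (hk : k + 1 < r) (J : ℕ) :
    partitionGenFun (GordonParts r (k + 1) J) = partitionGenFun (GordonParts r k J) +
      X ^ ((J + 1) * (k + 1)) * partitionGenFun (GordonParts r (r - 1 - (k + 1)) (J + 1)) := by
  rw [← partitionGenFun_gordonParts_count_eq hk J]
  refine partitionGenFun_eq_add (fun s => ?_) fun s hs hs' => ?_
  · refine ⟨fun hs => ?_, ?_⟩
    · rcases Nat.lt_succ_iff_lt_or_eq.mp (Nat.lt_succ_of_le hs.2.2) with h | h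
      · exact Or.inl ⟨hs.1, hs.2.1, Nat.le_of_lt_succ h⟩
      · exact Or.inr ⟨hs, h⟩
    · rintro (hs | hs)
      · exact ⟨hs.1, hs.2.1, hs.2.2.trans (Nat.le_succ k)⟩
      · exact hs.1
  · have := hs.2.2
    have := hs'.2
    omega

lemma map_partitionGenFun_gordonParts_mul_prod {S : Type*} [CommRing S] (φ : ℤ⟦X⟧ →+* S)
    {r N : ℕ} (hK : φ X ^ ((2 * r + 1) * N) = 0) {J : ℕ} (hJ : J ≤ (2 * r + 1) * N)
    {k : ℕ} (hk : k < r) :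
    φ (partitionGenFun (GordonParts r k J)) *
      ∏ m ∈ Ico J ((2 * r + 1) * N), (1 - φ X ^ (m + 1)) =
        andrewsSum (φ X) r (k + 1) J (N + 1) := by
  induction hJ using Nat.decreasingInduction generalizing k with
  | self =>
    rw [map_partitionGenFun_eq_one φ hK (by simp [GordonParts]) fun s hs => hs.2.1,
      andrewsSum_eq_one (by omega) (by omega) hK]
    simp
  | of_succ J hJ ih =>
    rw [prod_eq_prod_Ico_succ_bot hJ]
    induction k with
    | zero =>
      have h := ih (k := r - 1) (by omega)
      rw [Nat.sub_add_cancel (by omega)] at h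
      rw [partitionGenFun_gordonParts_zero hk, andrewsSum_succ hk J hK, andrewsSum_zero,
        Nat.sub_zero, ← h]
      ring
    | succ k ihk =>
      have h := ih (k := r - 1 - (k + 1)) (by omega)
      rw [show r - 1 - (k + 1) + 1 = r - (k + 1) by omega] at h
      rw [partitionGenFun_gordonParts_succ hk, andrewsSum_succ hk J hK,
        ← ihk (by omega), ← h]
      simp only [map_add, map_mul, map_pow]
      ring

end PartitionGenFun

section Residues

/-- `x` is not congruent to `0`, `c` or `-c` modulo `2 * r + 1`. -/
def GordonResidue (r c x : ℕ) : Prop :=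
  (x : ZMod (2 * r + 1)) ≠ 0 ∧ (x : ZMod (2 * r + 1)) ≠ (c : ZMod (2 * r + 1)) ∧
    (x : ZMod (2 * r + 1)) ≠ -(c : ZMod (2 * r + 1))

lemma not_gordonResidue_iff {r i : ℕ} (hi : 0 < i) (hir : i ≤ r) (j : ℕ) {t : ℕ}
    (ht : t < 2 * r + 1) :
    ¬ GordonResidue r i ((2 * r + 1) * j + t + 1) ↔
      t = 2 * r ∨ t = 2 * r - i ∨ t = i - 1 := by
  have hcast : (((2 * r + 1) * j + t + 1 : ℕ) : ZMod (2 * r + 1)) = ((t + 1 : ℕ) : ZMod _) := by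
    rw [add_assoc, Nat.cast_add, Nat.cast_mul, ZMod.natCast_self, zero_mul, zero_add]
  have h1 : ((t + 1 : ℕ) : ZMod (2 * r + 1)) = 0 ↔ t = 2 * r := by
    rw [ZMod.natCast_eq_zero_iff]
    refine ⟨fun h => ?_, fun h => by simp [h]⟩
    have := Nat.le_of_dvd (by omega) h
    omega
  have h2 : ((t + 1 : ℕ) : ZMod (2 * r + 1)) = (i : ZMod (2 * r + 1)) ↔ t = i - 1 := by
    rw [ZMod.natCast_eq_natCast_iff', Nat.mod_eq_of_lt (show i < 2 * r + 1 by omega)]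
    rcases Nat.lt_or_ge (t + 1) (2 * r + 1) with h | h
    · rw [Nat.mod_eq_of_lt h]; omega
    · rw [show t + 1 = 2 * r + 1 by omega, Nat.mod_self]; omega
  have h3 : ((t + 1 : ℕ) : ZMod (2 * r + 1)) = -(i : ZMod (2 * r + 1)) ↔ t = 2 * r - i := by
    rw [eq_neg_iff_add_eq_zero, ← Nat.cast_add, ZMod.natCast_eq_zero_iff]
    constructor
    · rintro ⟨c, hc⟩
      have : c < 2 := by by_contra! h; nlinarith
      interval_cases c <;> omega
    · intro h
      rw [show t + 1 + i = 2 * r + 1 by omega]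
  rw [GordonResidue, hcast, ← h1, ← h2, ← h3]
  tauto

lemma prod_not_gordonResidue {S : Type*} [CommRing S] (q : S) {r i : ℕ}
    [DecidablePred (GordonResidue r i)] (hi : 0 < i) (hir : i ≤ r) (N : ℕ) :
    ∏ m ∈ range ((2 * r + 1) * N), (if GordonResidue r i (m + 1) then 1 else 1 - q ^ (m + 1)) =
      (∏ m ∈ range N, (1 - q ^ ((2 * r + 1) * (m + 1)))) *
        (∏ m ∈ range N, (1 - q ^ ((2 * r + 1) * m + (2 * r + 1 - i)))) *
        ∏ m ∈ range N, (1 - q ^ ((2 * r + 1) * m + i)) := by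
  induction N with
  | zero => simp
  | succ N ih =>
    have hblock : ∏ t ∈ range (2 * r + 1), (if GordonResidue r i ((2 * r + 1) * N + t + 1) then 1
        else 1 - q ^ ((2 * r + 1) * N + t + 1)) =
        (1 - q ^ ((2 * r + 1) * (N + 1))) * ((1 - q ^ ((2 * r + 1) * N + (2 * r + 1 - i))) *
          (1 - q ^ ((2 * r + 1) * N + i))) := by
      have hsub : ({2 * r, 2 * r - i, i - 1} : Finset ℕ) ⊆ range (2 * r + 1) := by
        intro t ht
        simp only [mem_insert, mem_singleton] at ht
        rw [mem_range]
        omega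
      rw [← prod_subset hsub]
      · rw [prod_congr rfl fun t ht => if_neg ((not_gordonResidue_iff hi hir N
          (mem_range.mp (hsub ht))).mpr (by simpa using ht)),
          prod_insert (by simp; omega), prod_insert (by simp; omega), prod_singleton,
          show (2 * r + 1) * N + 2 * r + 1 = (2 * r + 1) * (N + 1) by ring,
          show (2 * r + 1) * N + (2 * r - i) + 1 = (2 * r + 1) * N + (2 * r + 1 - i) by omega,
          show (2 * r + 1) * N + (i - 1) + 1 = (2 * r + 1) * N + i by omega]
      · intro t ht hnot
        rw [if_pos]
        by_contra h
        exact hnot (by simpa using (not_gordonResidue_iff hi hir N (mem_range.mp ht)).mp h)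
    rw [Nat.mul_succ, prod_range_add, ih, hblock, prod_range_succ, prod_range_succ,
      prod_range_succ]
    ring

end Residues

lemma map_partitionGenFun_gordonResidue {S : Type*} [CommRing S] (φ : ℤ⟦X⟧ →+* S) {r i N : ℕ}
    (hi : 0 < i) (hir : i ≤ r) (hK : φ X ^ ((2 * r + 1) * N) = 0) :
    φ (partitionGenFun fun s => ∀ x ∈ s, 0 < x ∧ GordonResidue r i x) =
      φ (partitionGenFun (GordonParts r (i - 1) 0)) := by
  classical
  have hA := map_partitionGenFun_mul_prod φ hK (GordonResidue r i) (Nat.zero_le _)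
  have hB := map_partitionGenFun_gordonParts_mul_prod φ hK (Nat.zero_le _)
    (show i - 1 < r by omega)
  rw [Nat.sub_add_cancel hi, ← map_jacobi_triple_product φ X_ne_zero hir hK,
    ← prod_not_gordonResidue (φ X) hi hir N, ← range_eq_Ico] at hB
  rw [← range_eq_Ico] at hA
  have hsplit : ∏ m ∈ range ((2 * r + 1) * N), (1 - φ X ^ (m + 1)) =
      (∏ m ∈ range ((2 * r + 1) * N),
        (if GordonResidue r i (m + 1) then 1 - φ X ^ (m + 1) else 1)) *
      ∏ m ∈ range ((2 * r + 1) * N),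
        (if GordonResidue r i (m + 1) then 1 else 1 - φ X ^ (m + 1)) := by
    rw [← prod_mul_distrib]
    exact prod_congr rfl fun m _ => by split_ifs <;> simp
  have hunit : IsUnit (∏ m ∈ range ((2 * r + 1) * N),
      (if GordonResidue r i (m + 1) then 1 else 1 - φ X ^ (m + 1))) := by
    rw [IsUnit.prod_iff]
    intro m _
    split_ifs
    · exact isUnit_one
    · exact (IsNilpotent.pow_of_pos ⟨_, hK⟩ (Nat.succ_ne_zero m)).isUnit_one_sub
  rw [hsplit, ← mul_assoc] at hB
  have hB' := hunit.mul_right_cancel (hB.trans (one_mul _).symm)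
  linear_combination (φ (partitionGenFun (GordonParts r (i - 1) 0))) * hA -
    (φ (partitionGenFun fun s => ∀ x ∈ s, 0 < x ∧ GordonResidue r i x)) * hB'

/-- Rogers–Ramanujan–Gordon identities: for `r ≥ 2`, `1 ≤ i ≤ r`, and every `n ≥ 0`, the
number of partitions of `n` into parts not congruent to `0, ±i` mod `2r+1` equals the number
of partitions of `n` satisfying the Gordon difference condition for `r` with at most `i - 1`
parts equal to `1`. -/
theorem rogers_ramanujan_gordon (r i n : ℕ) (hr : 2 ≤ r) (hi1 : 1 ≤ i) (hir : i ≤ r) :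
    ACountMod r i n = BCount r i 0 n := by
  let I : Ideal ℤ⟦X⟧ := Ideal.span {X ^ ((2 * r + 1) * (n + 1))}
  have hK : Ideal.Quotient.mk I X ^ ((2 * r + 1) * (n + 1)) = 0 := by
    rw [← map_pow, Ideal.Quotient.eq_zero_iff_mem]
    exact Ideal.mem_span_singleton_self _
  have h := map_partitionGenFun_gordonResidue (Ideal.Quotient.mk I) hi1 hir hK
  rw [Ideal.Quotient.eq, Ideal.mem_span_singleton, X_pow_dvd_iff] at h
  have hn := h n (by nlinarith)
  rw [map_sub, sub_eq_zero, coeff_partitionGenFun, coeff_partitionGenFun, Nat.cast_inj] at hn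
  rw [show BCount r i 0 n = _ from hn.symm]
  exact Nat.card_congr (Equiv.subtypeEquivRight fun p =>
    forall₂_congr fun x hx => (and_iff_right (p.parts_pos hx)).symm)
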